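/- There are no points V, P, I in three-dimensional Euclidean space (EuclideanSpace ℝ (Fin 3)) and real numbers d, t1, t2, t3, t4, t5, t6, t7, t8, t9, t10, t11, t12, t13 satisfying all of the following constraints of the mafia-fraud trace of the Brands–Chaum protocol: d > 0; dist(V, P) > d; t2 = t1 + dist(P, I); t3 = t2 + dist(V, I); t4 = t3 + dist(V, I); t5 = t4 + dist(P, I); t6 = t5 + dist(P, I); t7 = t6 + dist(V, I); (t7 ∸ t3) ≤ 2·d; t9 = t8 + dist(P, I) and t8 ≥ t5; t11 = t10 + dist(V, I) and t11 ≥ t7; t13 = t12 + dist(V, I) and t13 ≥ t11. -/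

import Mathlib

/-- The monus function on the reals: `x ∸ y = x - y` if `y < x`, else `0`. -/
noncomputable def monus (x y : ℝ) : ℝ := if y < x then x - y else 0

theorem mafia_fraud_trace_unfeasible_3d :
    ¬ ∃ (V P I : EuclideanSpace ℝ (Fin 3))
        (d t1 t2 t3 t4 t5 t6 t7 t8 t9 t10 t11 t12 t13 : ℝ),
      d > 0 ∧ dist V P > d ∧
      t2 = t1 + dist P I ∧
      t3 = t2 + dist V I ∧
      t4 = t3 + dist V I ∧
      t5 = t4 + dist P I ∧
      t6 = t5 + dist P I ∧
      t7 = t6 + dist V I ∧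
      monus t7 t3 ≤ 2 * d ∧
      (t9 = t8 + dist P I ∧ t8 ≥ t5) ∧
      (t11 = t10 + dist V I ∧ t11 ≥ t7) ∧
      (t13 = t12 + dist V I ∧ t13 ≥ t11) := by
  rintro ⟨V, P, I, d, t1, t2, t3, t4, t5, t6, t7, t8, t9, t10, t11, t12, t13,
    hd, hVP, -, -, h4, h5, h6, h7, hcheck, -, -, -⟩
  have htri : dist V P ≤ dist V I + dist P I := dist_triangle_right V P I
  have hlt : t3 < t7 := by linarith
  rw [monus, if_pos hlt] at hcheck
  linarith
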